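/- For all n ≥ 1, the number of permutations π ∈ S_n such that both π and θ(π) avoid the pattern 312 is t_n(312) = 2^{n−1}. -/

import Mathlib

/-- The one-line word of the image of `π` under the fundamental bijection:
write `π` in standard cycle form (every cycle written with its largest element
first, cycles listed in increasing order of their largest elements) and erase
the parentheses.  The cycle maxima are exactly the `x` with `π^[k] x ≤ x` for
all `k`, and the cycle of `x` is `x, π x, π² x, …` up to the period of `x`. -/
noncomputable def fundWord {n : ℕ} (π : Equiv.Perm (Fin n)) : List (Fin n) :=
  ((List.finRange n).filter fun x => (List.range n).all fun k => decide ((⇑π)^[k] x ≤ x)).flatMap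
    fun x => (List.range (Function.minimalPeriod (⇑π) x)).map fun k => (⇑π)^[k] x

/-- The permutation whose one-line notation is the word `w`
(junk value if `w` is not the one-line notation of a permutation). -/
noncomputable def permOfWord {n : ℕ} (w : List (Fin n)) : Equiv.Perm (Fin n) :=
  Function.invFun (fun σ : Equiv.Perm (Fin n) => (List.finRange n).map ⇑σ) w

/-- The fundamental bijection `θ`. -/
noncomputable def theta {n : ℕ} (π : Equiv.Perm (Fin n)) : Equiv.Perm (Fin n) :=
  permOfWord (fundWord π)

/-- `π` contains the pattern `σ`. -/
def Contains {k n : ℕ} (σ : Equiv.Perm (Fin k)) (π : Equiv.Perm (Fin n)) : Prop :=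
  ∃ f : Fin k → Fin n, StrictMono f ∧ ∀ a b : Fin k, π (f a) < π (f b) ↔ σ a < σ b

/-- `π` avoids the pattern `σ`. -/
def Avoids {k n : ℕ} (π : Equiv.Perm (Fin n)) (σ : Equiv.Perm (Fin k)) : Prop :=
  ¬ Contains σ π

noncomputable def p123 : Equiv.Perm (Fin 3) := Equiv.ofBijective ![0, 1, 2] (by decide)
noncomputable def p132 : Equiv.Perm (Fin 3) := Equiv.ofBijective ![0, 2, 1] (by decide)
noncomputable def p213 : Equiv.Perm (Fin 3) := Equiv.ofBijective ![1, 0, 2] (by decide)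
noncomputable def p231 : Equiv.Perm (Fin 3) := Equiv.ofBijective ![1, 2, 0] (by decide)
noncomputable def p312 : Equiv.Perm (Fin 3) := Equiv.ofBijective ![2, 0, 1] (by decide)
noncomputable def p321 : Equiv.Perm (Fin 3) := Equiv.ofBijective ![2, 1, 0] (by decide)

/-- The direct sum `π ⊕ τ` of two permutations. -/
def directSum {n m : ℕ} (π : Equiv.Perm (Fin n)) (τ : Equiv.Perm (Fin m)) :
    Equiv.Perm (Fin (n + m)) :=
  finSumFinEquiv.permCongr (Equiv.sumCongr π τ)

/-- A permutation is irreducible if it is not a direct sum of two nonempty permutations. -/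
def IrreduciblePerm {n : ℕ} (π : Equiv.Perm (Fin n)) : Prop :=
  ¬ ∃ (a b : ℕ) (_ : 0 < a) (_ : 0 < b) (h : a + b = n)
      (σ : Equiv.Perm (Fin a)) (τ : Equiv.Perm (Fin b)),
      π = (finCongr h).permCongr (directSum σ τ)

/-- A permutation is cyclic if its cycle decomposition is a single cycle of full length,
i.e. it acts transitively. -/
def IsCyclicPerm {n : ℕ} (π : Equiv.Perm (Fin n)) : Prop :=
  ∀ x y : Fin n, ∃ k : ℕ, (⇑π)^[k] x = y

theorem avoids_p312_iff {n : ℕ} (π : Equiv.Perm (Fin n)) :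
    Avoids π p312 ↔ ∀ i j k, i < j → j < k → ¬ (π j < π k ∧ π k < π i) := by
  have h0 : p312 0 = 2 := rfl
  have h1 : p312 1 = 0 := rfl
  have h2 : p312 2 = 1 := rfl
  constructor
  · intro h i j k hij hjk ⟨h₁, h₂⟩
    refine h ⟨![i, j, k], ?_, ?_⟩
    · intro a b hab
      fin_cases a <;> fin_cases b <;> simp_all [hij.trans hjk]
    · intro a b
      have h₃ := h₁.trans h₂
      fin_cases a <;> fin_cases b <;> simp [h0, h1, h2, h₁, h₂, h₃, h₁.le, h₂.le, h₃.le]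
  · rintro h ⟨f, hf, hσ⟩
    refine h (f 0) (f 1) (f 2) (hf (by decide)) (hf (by decide)) ⟨?_, ?_⟩
    · rw [hσ, h1, h2]; decide
    · rw [hσ, h2, h0]; decide

section CycleWord

variable {n : ℕ} (π : Equiv.Perm (Fin n))

theorem minimalPeriod_pos (x : Fin n) : 0 < Function.minimalPeriod π x :=
  Function.minimalPeriod_pos_of_mem_periodicPts (π.injective.mem_periodicPts x)

theorem iterate_le_iff (x : Fin n) :
    ((List.range n).all fun k => decide ((⇑π)^[k] x ≤ x)) = true ↔ ∀ k, (⇑π)^[k] x ≤ x := by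
  simp only [List.all_eq_true, List.mem_range, decide_eq_true_eq]
  refine ⟨fun h k => ?_, fun h k _ => h k⟩
  rw [← Function.iterate_mod_minimalPeriod_eq]
  refine h _ ((Nat.mod_lt _ (minimalPeriod_pos π x)).trans_le ?_)
  simpa using Function.minimalPeriod_le_card (f := π) (x := x)

theorem exists_iterate_eq_of_iterate_eq {x y : Fin n} {i : ℕ} (h : (⇑π)^[i] x = y) :
    ∃ j, (⇑π)^[j] y = x := by
  subst h
  have hp := minimalPeriod_pos π x
  refine ⟨(Function.minimalPeriod π x - 1) * i, ?_⟩
  rw [← Function.iterate_add_apply, ← Nat.succ_mul, Nat.succ_eq_add_one, Nat.sub_add_cancel hp]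
  exact (Function.isPeriodicPt_minimalPeriod π x).mul_const i

theorem exists_cycle_max (y : Fin n) : ∃ x, (∀ k, (⇑π)^[k] x ≤ x) ∧ ∃ k, (⇑π)^[k] x = y := by
  obtain ⟨x, ⟨i, hi⟩, hx⟩ := (Set.toFinite {x | ∃ k, (⇑π)^[k] y = x}).exists_maximal ⟨y, 0, rfl⟩
  refine ⟨x, fun k => ?_, exists_iterate_eq_of_iterate_eq π hi⟩
  by_contra! hlt
  refine hlt.not_ge (hx ⟨k + i, ?_⟩ hlt.le)
  rw [Function.iterate_add_apply, hi]

theorem mem_fundWord (y : Fin n) : y ∈ fundWord π := by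
  obtain ⟨x, hx, k, hk⟩ := exists_cycle_max π y
  simp only [fundWord, List.mem_flatMap, List.mem_filter, iterate_le_iff, List.mem_map,
    List.mem_range]
  refine ⟨x, ⟨List.mem_finRange x, hx⟩, k % Function.minimalPeriod π x,
    Nat.mod_lt _ (minimalPeriod_pos π x), ?_⟩
  rw [Function.iterate_mod_minimalPeriod_eq, hk]

theorem nodup_fundWord : (fundWord π).Nodup := by
  rw [fundWord, List.nodup_flatMap]
  constructor
  · intro x _
    refine List.Nodup.map_on (fun i hi j hj h => ?_) List.nodup_range
    exact Function.iterate_injOn_Iio_minimalPeriod (List.mem_range.1 hi) (List.mem_range.1 hj) h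
  · refine ((List.nodup_finRange n).filter _).pairwise_of_forall_ne fun x hx y hy hxy => ?_
    simp only [List.mem_filter, iterate_le_iff] at hx hy
    rw [Function.onFun, List.disjoint_left]
    simp only [List.mem_map, not_exists, not_and]
    rintro z ⟨i, -, hi⟩ j - hj
    obtain ⟨i', hi'⟩ := exists_iterate_eq_of_iterate_eq π hi
    obtain ⟨j', hj'⟩ := exists_iterate_eq_of_iterate_eq π hj
    refine hxy (le_antisymm ?_ ?_)
    · rw [← hi', ← hj, ← Function.iterate_add_apply]; exact hy.2 _
    · rw [← hj', ← hi, ← Function.iterate_add_apply]; exact hx.2 _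

theorem map_permOfWord {w : List (Fin n)} (hw : w.Nodup) (hmem : ∀ x, x ∈ w) :
    (List.finRange n).map (permOfWord w) = w := by
  refine Function.invFun_eq (f := fun σ : Equiv.Perm (Fin n) => (List.finRange n).map ⇑σ) ?_
  have hlen : n = w.length := by
    simpa using (Fintype.card_congr (hw.getEquivOfForallMemList w hmem)).symm
  refine ⟨(finCongr hlen).trans (hw.getEquivOfForallMemList w hmem), ?_⟩
  apply List.ext_getElem
  · simpa using hlen
  · intro i h₁ h₂
    simp

theorem map_theta : (List.finRange n).map (theta π) = fundWord π :=
  map_permOfWord (nodup_fundWord π) (mem_fundWord π)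

theorem avoids_theta_iff :
    Avoids (theta π) p312 ↔ (fundWord π).Triplewise fun a b c => ¬ (b < c ∧ c < a) := by
  rw [avoids_p312_iff, ← map_theta, List.triplewise_map, List.triplewise_iff_getElem]
  simp only [List.getElem_finRange, List.length_finRange]
  exact ⟨fun h i j k hij hjk hk => h _ _ _ (by simpa using hij) (by simpa using hjk),
    fun h i j k hij hjk => h i j k hij hjk k.2⟩

variable {π}

theorem involutive_of_avoids (h : Avoids π p312) (hθ : Avoids (theta π) p312) :
    Function.Involutive π := by
  intro y
  obtain ⟨x, hx, k, rfl⟩ := exists_cycle_max π y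
  suffices hxx : π (π x) = x by
    rw [← Function.iterate_succ_apply' (⇑π), ← Function.iterate_succ_apply' (⇑π),
      Function.iterate_succ_apply, Function.iterate_succ_apply, hxx]
  by_contra hxx
  rw [avoids_theta_iff, fundWord] at hθ
  have hmem : x ∈ (List.finRange n).filter
      fun x => (List.range n).all fun k => decide ((⇑π)^[k] x ≤ x) := by
    exact List.mem_filter.2 ⟨List.mem_finRange x, (iterate_le_iff π x).2 hx⟩
  obtain ⟨s, t, hst⟩ := List.append_of_mem hmem
  rw [hst, List.flatMap_append, List.flatMap_cons, List.triplewise_append,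
    List.triplewise_append] at hθ
  have hc := hθ.2.1.1
  rw [List.triplewise_map, List.triplewise_iff_getElem] at hc
  simp only [List.getElem_range, List.length_range] at hc
  set p := Function.minimalPeriod π x with hp
  have hper : (⇑π)^[p] x = x := Function.isPeriodicPt_minimalPeriod π x
  have hp3 : 3 ≤ p := by
    by_contra! hlt
    have := minimalPeriod_pos π x
    have : p = 1 ∨ p = 2 := by omega
    rcases this with h1 | h2
    · rw [h1] at hper
      simp only [Function.iterate_one] at hper
      exact hxx (by rw [hper, hper])
    · rw [h2] at hper
      exact hxx hper
  have hinj : ∀ i j, i < p → j < p → (⇑π)^[i] x = (⇑π)^[j] x → i = j := fun i j hi hj hij =>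
    Function.iterate_injOn_Iio_minimalPeriod (f := π) (x := x) hi hj hij
  have hlt0 : ∀ i, 0 < i → i < p → (⇑π)^[i] x < x := fun i hi hip =>
    lt_of_le_of_ne (hx i) fun he => hi.ne' (hinj i 0 hip (by omega) he)
  have hdec : ∀ i j, i < j → j < p → (⇑π)^[j] x < (⇑π)^[i] x := by
    intro i j hij hj
    rcases Nat.eq_zero_or_pos i with rfl | hi
    · exact hlt0 j hij hj
    · refine lt_of_le_of_ne ?_ fun he => hij.ne' (hinj j i hj (by omega) he)
      by_contra! hlt
      exact hc 0 i j hi hij hj ⟨hlt, hlt0 j (by omega) hj⟩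
  obtain ⟨q, hq⟩ : ∃ q, p = q + 3 := ⟨p - 3, by omega⟩
  have h3 : π ((⇑π)^[q + 2] x) = x := by
    rw [← Function.iterate_succ_apply' (⇑π), Nat.succ_eq_add_one, ← hq, hper]
  refine (avoids_p312_iff π).1 h ((⇑π)^[q + 2] x) ((⇑π)^[q + 1] x) ((⇑π)^[q] x)
    (hdec _ _ (by omega) (by omega)) (hdec _ _ (by omega) (by omega)) ?_
  rw [h3, ← Function.iterate_succ_apply' (⇑π), ← Function.iterate_succ_apply' (⇑π)]
  exact ⟨hdec _ _ (by omega) (by omega), hlt0 _ (by omega) (by omega)⟩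

theorem pairwise_fundWord_of_involutive (hπ : Function.Involutive π) :
    (fundWord π).Pairwise fun a b =>
      max a (π a) < max b (π b) ∨ max a (π a) = max b (π b) ∧ b < a := by
  have hmem : ∀ x, (∀ k, (⇑π)^[k] x ≤ x) → ∀ y k, (⇑π)^[k] x = y → max y (π y) = x := by
    rintro x hx y k rfl
    have h1 : π x ≤ x := hx 1
    rcases Nat.even_or_odd k with hk | hk
    · rw [hπ.iterate_even hk]
      simpa using h1
    · rw [hπ.iterate_odd hk, hπ x]
      simpa using h1
  rw [fundWord, List.pairwise_flatMap]
  constructor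
  · intro x hx
    simp only [List.mem_filter, iterate_le_iff] at hx
    have hx := hx.2
    refine List.pairwise_map.2 (List.pairwise_lt_range.imp_of_mem fun {i j} hi hj hij => ?_)
    right
    have hp : Function.minimalPeriod π x ≤ 2 :=
      Function.IsPeriodicPt.minimalPeriod_le (by norm_num) (hπ x)
    rw [List.mem_range] at hi hj
    refine ⟨(hmem x hx _ i rfl).trans (hmem x hx _ j rfl).symm, ?_⟩
    obtain rfl : i = 0 := by omega
    refine lt_of_le_of_ne (hx j) fun he => hij.ne' ?_
    exact Function.iterate_injOn_Iio_minimalPeriod (f := π) (x := x) hj hi he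
  · refine ((List.pairwise_lt_finRange n).filter _).imp_of_mem fun {x y} hx hy hxy => ?_
    simp only [List.mem_filter, iterate_le_iff] at hx hy
    simp only [List.mem_map]
    rintro a ⟨i, -, hi⟩ b ⟨j, -, hj⟩
    left
    rwa [hmem x hx.2 a i hi, hmem y hy.2 b j hj]

theorem avoids_theta_of_involutive (hπ : Function.Involutive π) (h : Avoids π p312) :
    Avoids (theta π) p312 := by
  have hR := pairwise_fundWord_of_involutive hπ
  rw [← map_theta, List.pairwise_map, List.pairwise_iff_getElem] at hR
  simp only [List.getElem_finRange, List.length_finRange] at hR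
  rw [avoids_p312_iff] at h ⊢
  rintro i j k hij hjk ⟨h₁, h₂⟩
  have hab := hR i j i.2 j.2 hij
  have hbc := hR j k j.2 k.2 hjk
  simp only [Fin.cast_mk, Fin.eta] at hab hbc
  generalize theta π i = a at *
  generalize theta π j = b at *
  generalize theta π k = c at *
  have hM : max b (π b) < max c (π c) := by
    rcases hbc with h | h
    · exact h
    · exact absurd h.2 h₁.not_gt
  have hab' : max a (π a) ≤ max b (π b) := by
    rcases hab with h | h
    · exact h.le
    · exact h.1.le
  have haM := (le_max_left a (π a)).trans hab'
  have hb : max b (π b) = π b := max_eq_right_iff.2 <| by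
    by_contra! hlt
    rw [max_eq_left hlt.le] at haM
    exact (h₁.trans h₂).not_ge haM
  rw [hb] at haM hM
  have hc : π b < π c := by
    rcases lt_max_iff.1 hM with h | h
    · exact absurd (h₂.trans_le haM) h.not_gt
    · exact h
  refine h c (π b) (π c) (h₂.trans_le haM) hc ?_
  rw [hπ, hπ]
  exact ⟨h₁, h₂.trans_le (haM.trans hc.le)⟩

end CycleWord

/-- `[l, h)` is a block containing `x` of the decomposition of `ℕ` with cut points `B`. -/
def IsBlock (B : Set ℕ) (l h x : ℕ) : Prop :=
  l ∈ B ∧ h ∈ B ∧ l ≤ x ∧ x < h ∧ ∀ b ∈ B, b ≤ l ∨ h ≤ b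

/-- The lengths of the initial segments that `π` maps to themselves. -/
def invariantPrefixes {n : ℕ} (π : Equiv.Perm (Fin n)) : Set ℕ :=
  {b | b ≤ n ∧ ∀ j : Fin n, (j : ℕ) < b → (π j : ℕ) < b}

theorem exists_isBlock {B : Set ℕ} {n x : ℕ} (h0 : 0 ∈ B) (hn : n ∈ B) (hx : x < n) :
    ∃ l h, IsBlock B l h x := by
  classical
  have hex : ∃ h, h ∈ B ∧ x < h := ⟨n, hn, hx⟩
  refine ⟨Nat.findGreatest (· ∈ B) x, Nat.find hex,
    Nat.findGreatest_spec (P := (· ∈ B)) (Nat.zero_le x) h0, (Nat.find_spec hex).1,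
    Nat.findGreatest_le x, (Nat.find_spec hex).2, fun b hb => ?_⟩
  rcases le_or_gt b x with h | h
  · exact Or.inl (Nat.le_findGreatest h hb)
  · exact Or.inr (Nat.find_min' hex ⟨hb, h⟩)

theorem IsBlock.eq {B : Set ℕ} {l h l' h' x : ℕ} (H : IsBlock B l h x) (H' : IsBlock B l' h' x) :
    l = l' ∧ h = h' := by
  obtain ⟨hl, hh, hlx, hxh, H⟩ := H
  obtain ⟨hl', hh', hlx', hxh', H'⟩ := H'
  have h1 := H _ hl'
  have h2 := H _ hh'
  have h3 := H' _ hl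
  have h4 := H' _ hh
  omega

theorem IsBlock.of_mem {B : Set ℕ} {l h x y : ℕ} (H : IsBlock B l h x) (hl : l ≤ y) (hh : y < h) :
    IsBlock B l h y :=
  ⟨H.1, H.2.1, hl, hh, H.2.2.2.2⟩

/-- `π` reverses each block of the decomposition with cut points `B`. -/
def ReversesBlocks {n : ℕ} (π : Equiv.Perm (Fin n)) (B : Set ℕ) : Prop :=
  ∀ (l h : ℕ) (x : Fin n), IsBlock B l h x → (π x : ℕ) + x + 1 = l + h

section ReversesBlocks

variable {n : ℕ} {π : Equiv.Perm (Fin n)} {B : Set ℕ}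

theorem exists_reversesBlocks (h0 : 0 ∈ B) (hn : n ∈ B) (hle : ∀ b ∈ B, b ≤ n) :
    ∃ π : Equiv.Perm (Fin n), ReversesBlocks π B := by
  choose l h H using fun x : Fin n => exists_isBlock h0 hn x.2
  have hlt : ∀ x : Fin n, l x + h x - 1 - x < n := fun x => by
    have h1 := hle _ (H x).2.1
    have h2 := (H x).2.2.1
    have h3 := (H x).2.2.2.1
    omega
  have hinv : Function.Involutive fun x : Fin n => (⟨l x + h x - 1 - x, hlt x⟩ : Fin n) := by
    intro x
    have h2 := (H x).2.2.1
    have h3 := (H x).2.2.2.1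
    have h4 := (H ⟨l x + h x - 1 - x, hlt x⟩).eq
      ((H x).of_mem (y := l x + h x - 1 - x) (by omega) (by omega))
    apply Fin.ext
    simp only [h4.1, h4.2]
    omega
  refine ⟨hinv.toPerm, fun l' h' x H' => ?_⟩
  have h2 := (H x).2.2.1
  have h3 := (H x).2.2.2.1
  have h4 := (H x).eq H'
  simp only [Function.Involutive.coe_toPerm]
  omega

theorem ReversesBlocks.involutive (h0 : 0 ∈ B) (hn : n ∈ B) (H : ReversesBlocks π B) :
    Function.Involutive π := by
  intro x
  obtain ⟨l, h, hb⟩ := exists_isBlock h0 hn x.2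
  have h1 := H l h x hb
  obtain ⟨-, -, h2, h3, -⟩ := id hb
  have h4 := H l h (π x) (hb.of_mem (by omega) (by omega))
  apply Fin.ext
  omega

theorem ReversesBlocks.isBlock_of_lt (h0 : 0 ∈ B) (hn : n ∈ B) (H : ReversesBlocks π B)
    {x y : Fin n} (hxy : x < y) (hπ : π y < π x) {l h : ℕ} (hb : IsBlock B l h x) :
    IsBlock B l h y := by
  obtain ⟨l', h', hb'⟩ := exists_isBlock h0 hn y.2
  have h1 := H l h x hb
  have h2 := H l' h' y hb'
  obtain ⟨-, hh, h3, h4, -⟩ := id hb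
  obtain ⟨-, -, h5, h6, hB⟩ := id hb'
  have h7 := hB _ hh
  rw [Fin.lt_def] at hxy hπ
  exact hb.of_mem (by omega) (by omega)

theorem ReversesBlocks.avoids (h0 : 0 ∈ B) (hn : n ∈ B) (H : ReversesBlocks π B) :
    Avoids π p312 := by
  rw [avoids_p312_iff]
  rintro i j k hij hjk ⟨h₁, h₂⟩
  obtain ⟨l, h, hb⟩ := exists_isBlock h0 hn i.2
  have hj := H l h j (H.isBlock_of_lt h0 hn hij (h₁.trans h₂) hb)
  have hk := H l h k (H.isBlock_of_lt h0 hn (hij.trans hjk) h₂ hb)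
  rw [Fin.lt_def] at *
  omega

theorem ReversesBlocks.invariantPrefixes_eq (h0 : 0 ∈ B) (hn : n ∈ B) (hle : ∀ b ∈ B, b ≤ n)
    (H : ReversesBlocks π B) : invariantPrefixes π = B := by
  ext b
  constructor
  · rintro ⟨hbn, hb⟩
    by_contra hbB
    have hbn : b < n := lt_of_le_of_ne hbn fun h => hbB (h ▸ hn)
    obtain ⟨l, h, hbl⟩ := exists_isBlock h0 hn hbn
    obtain ⟨hl, -, h1, h2, -⟩ := id hbl
    have h3 : l < b := lt_of_le_of_ne h1 fun h => hbB (h ▸ hl)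
    have h4 := hb ⟨l, h3.trans hbn⟩ h3
    have h5 := H l h ⟨l, h3.trans hbn⟩ (hbl.of_mem le_rfl (h1.trans_lt h2))
    simp only at h5
    omega
  · refine fun hb => ⟨hle b hb, fun j hj => ?_⟩
    obtain ⟨l, h, hbl⟩ := exists_isBlock h0 hn j.2
    have h1 := H l h j hbl
    obtain ⟨-, -, h2, h3, h4⟩ := hbl
    have h5 := h4 b hb
    omega

theorem zero_mem_invariantPrefixes : 0 ∈ invariantPrefixes π :=
  ⟨Nat.zero_le n, fun _ h => absurd h (Nat.not_lt_zero _)⟩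

theorem self_mem_invariantPrefixes : n ∈ invariantPrefixes π :=
  ⟨le_rfl, fun j _ => (π j).2⟩

theorem reversesBlocks_of_avoids (hπ : Function.Involutive π) (h312 : Avoids π p312) :
    ReversesBlocks π (invariantPrefixes π) := by
  rw [avoids_p312_iff] at h312
  rintro l h x ⟨⟨-, hl⟩, ⟨hhn, hh⟩, hlx, hxh, hB⟩
  have hmaps : ∀ y : Fin n, l ≤ y → (y : ℕ) < h → l ≤ (π y : ℕ) ∧ (π y : ℕ) < h := by
    intro y h1 h2
    refine ⟨?_, hh y h2⟩
    by_contra! hlt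
    have := hl _ hlt
    rw [hπ] at this
    omega
  obtain ⟨a, ha⟩ : ∃ a : Fin n, (a : ℕ) = l := ⟨⟨l, by omega⟩, rfl⟩
  have hπa := hmaps a ha.ge (by omega)
  have hmem : (π a : ℕ) + 1 ∈ invariantPrefixes π := by
    refine ⟨(π a).2, fun j hj => ?_⟩
    by_contra! hlt
    have hja : l ≤ j := by
      by_contra! hjl
      have := hl j hjl
      omega
    have hne : j ≠ π a := by
      rintro rfl
      rw [hπ] at hlt
      omega
    have hne' : j ≠ a := by
      rintro rfl
      omega
    have hne₁ := Fin.val_ne_of_ne hne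
    have hne₂ := Fin.val_ne_of_ne hne'
    refine h312 j (π a) (π j) ?_ ?_ ⟨?_, ?_⟩
    · rw [Fin.lt_def]; omega
    · rw [Fin.lt_def]; omega
    · rw [hπ, hπ, Fin.lt_def]; omega
    · rw [hπ, Fin.lt_def]; omega
  have hah : (π a : ℕ) + 1 = h := by
    have := hB _ hmem
    omega
  have hanti : ∀ y z : Fin n, l ≤ y → y < z → (z : ℕ) < h → π z < π y := by
    intro y z hly hyz hzh
    rw [Fin.lt_def] at hyz
    by_contra! hle
    have hlt : π y < π z := lt_of_le_of_ne hle fun he => by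
      have := congrArg Fin.val (π.injective he)
      omega
    have hz := hmaps z (by omega) hzh
    rw [Fin.lt_def] at hlt
    have hay : (a : ℕ) ≠ y := by
      intro he
      obtain rfl := Fin.ext he
      omega
    have haz : (π z : ℕ) ≠ π a := by
      intro he
      have := congrArg Fin.val (π.injective (Fin.ext he))
      omega
    refine h312 a y z ?_ ?_ ⟨?_, ?_⟩ <;> rw [Fin.lt_def] <;> omega
  have hupper : ∀ d, ∀ y : Fin n, (y : ℕ) = l + d → (y : ℕ) < h → (π y : ℕ) + y + 1 ≤ l + h := by
    intro d
    induction d with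
    | zero =>
      intro y hy hyh
      obtain rfl : y = a := Fin.ext (by omega)
      omega
    | succ d ih =>
      intro y hy hyh
      have h1 := ih ⟨l + d, by omega⟩ rfl (by simp only; omega)
      have h2 := hanti ⟨l + d, by omega⟩ y (by simp) (by rw [Fin.lt_def]; simp only; omega) hyh
      rw [Fin.lt_def] at h2
      simp only at h1
      omega
  have hlower : ∀ d, ∀ y : Fin n, (y : ℕ) + d + 1 = h → l ≤ (y : ℕ) → l + h ≤ (π y : ℕ) + y + 1 := by
    intro d
    induction d with
    | zero =>
      intro y hy hly
      have := hmaps y hly (by omega)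
      omega
    | succ d ih =>
      intro y hy hly
      have h1 := ih ⟨y + 1, by omega⟩ (by simp only; omega) (by simp only; omega)
      have h2 := hanti y ⟨y + 1, by omega⟩ hly (by rw [Fin.lt_def]; simp) (by simp only; omega)
      rw [Fin.lt_def] at h2
      simp only at h1
      omega
  exact le_antisymm (hupper (x - l) x (by omega) hxh) (hlower (h - 1 - x) x (by omega) hlx)

end ReversesBlocks

theorem ReversesBlocks.unique {n : ℕ} {π τ : Equiv.Perm (Fin n)} {B : Set ℕ} (h0 : 0 ∈ B)
    (hn : n ∈ B) (hπ : ReversesBlocks π B) (hτ : ReversesBlocks τ B) : π = τ := by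
  refine Equiv.ext fun x => Fin.ext ?_
  obtain ⟨l, h, hb⟩ := exists_isBlock h0 hn x.2
  have h1 := hπ l h x hb
  have h2 := hτ l h x hb
  omega

theorem avoids_and_avoids_theta_iff {n : ℕ} (π : Equiv.Perm (Fin n)) :
    Avoids π p312 ∧ Avoids (theta π) p312 ↔ Function.Involutive π ∧ Avoids π p312 :=
  ⟨fun h => ⟨involutive_of_avoids h.1 h.2, h.1⟩,
    fun h => ⟨h.2, avoids_theta_of_involutive h.1 h.2⟩⟩

theorem card_involutive_avoids (n : ℕ) :
    Nat.card {π : Equiv.Perm (Fin n) // Function.Involutive π ∧ Avoids π p312} =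
      2 ^ (n - 1) := by
  classical
  have hcard : Nat.card (Finset.Ioo 0 n).powerset = 2 ^ (n - 1) := by
    rw [Nat.card_eq_fintype_card, Fintype.card_coe, Finset.card_powerset, Nat.card_Ioo,
      Nat.sub_zero]
  rw [← hcard]
  refine Nat.card_congr (Equiv.ofBijective (fun π =>
    ⟨(Finset.Ioo 0 n).filter (· ∈ invariantPrefixes π.1),
      Finset.mem_powerset.2 (Finset.filter_subset _ _)⟩) ⟨?_, ?_⟩)
  · rintro ⟨π, hπ, hπ'⟩ ⟨τ, hτ, hτ'⟩ h
    have hP : invariantPrefixes π = invariantPrefixes τ := by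
      ext b
      rcases Nat.eq_zero_or_pos b with rfl | hb
      · simp only [zero_mem_invariantPrefixes]
      rcases lt_trichotomy b n with hbn | rfl | hbn
      · simpa [hb, hbn] using Finset.ext_iff.1 (congrArg Subtype.val h) b
      · simp only [self_mem_invariantPrefixes]
      · exact iff_of_false (fun h => hbn.not_ge h.1) fun h => hbn.not_ge h.1
    refine Subtype.ext (ReversesBlocks.unique zero_mem_invariantPrefixes
      self_mem_invariantPrefixes (reversesBlocks_of_avoids hπ hπ') ?_)
    rw [hP]
    exact reversesBlocks_of_avoids hτ hτ'
  · rintro ⟨S, hS⟩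
    have hS : ∀ b ∈ S, 0 < b ∧ b < n := fun b hb =>
      Finset.mem_Ioo.1 (Finset.mem_powerset.1 hS hb)
    have h0 : 0 ∈ insert 0 (insert n (S : Set ℕ)) := by simp
    have hn : n ∈ insert 0 (insert n (S : Set ℕ)) := by simp
    have hle : ∀ b ∈ insert 0 (insert n (S : Set ℕ)), b ≤ n := by
      rintro b (rfl | rfl | hb)
      · exact Nat.zero_le n
      · exact le_rfl
      · exact (hS b hb).2.le
    obtain ⟨π, hπ⟩ := exists_reversesBlocks h0 hn hle
    refine ⟨⟨π, hπ.involutive h0 hn, hπ.avoids h0 hn⟩, Subtype.ext (Finset.ext fun b => ?_)⟩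
    simp only [hπ.invariantPrefixes_eq h0 hn hle, Finset.mem_filter, Finset.mem_Ioo,
      Set.mem_insert_iff, Finset.mem_coe]
    constructor
    · rintro ⟨⟨h1, h2⟩, rfl | rfl | h⟩
      · omega
      · omega
      · exact h
    · exact fun h => ⟨hS b h, Or.inr (Or.inr h)⟩

/-- for `n ≥ 1`, `t_n(312) = 2^{n-1}`. -/
theorem t_n_312 (n : ℕ) (hn : 1 ≤ n) :
    Nat.card {π : Equiv.Perm (Fin n) // Avoids π p312 ∧ Avoids (theta π) p312} =
      2 ^ (n - 1) := by
  simp only [avoids_and_avoids_theta_iff]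
  exact card_involutive_avoids n
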